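/- Let A ∈ SL₂(ℤ), let c be a nonzero real number, and let Γ_A = ℤ² ⋊_A ℤ be the semidirect product in which the generator 1 ∈ ℤ acts on ℤ² by the automorphism v ↦ A·v (so k ∈ ℤ acts by A^k). Let ρ_c : Γ_A → (ℝ₊*, ×) be the homomorphism ρ_c(v, k) = e^{ck}. Then there exists a group homomorphism ξ : Γ_A → GL₂(ℝ) fixing e₁, with det(ξ(γ)) = ρ_c(γ) for all γ and with ξ nontrivial on the commutator subgroup [Γ_A, Γ_A], if and only if e^c is an eigenvalue of A viewed as a real 2×2 matrix. -/

import Mathlib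

/-- The automorphism of `ℤ²` (written multiplicatively) induced by `A ∈ SL₂(ℤ)`,
acting by `v ↦ A·v`. -/
def torusAut (A : Matrix.SpecialLinearGroup (Fin 2) ℤ) :
    MulAut (Multiplicative (Fin 2 → ℤ)) :=
  AddEquiv.toMultiplicative (Matrix.SpecialLinearGroup.toLin' A).toAddEquiv

/-- The semidirect product `Γ_A = ℤ² ⋊_A ℤ`, where `k ∈ ℤ` acts on `ℤ²` by `v ↦ A^k·v`. -/
abbrev GammaA (A : Matrix.SpecialLinearGroup (Fin 2) ℤ) : Type :=
  SemidirectProduct (Multiplicative (Fin 2 → ℤ)) (Multiplicative ℤ)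
    (zpowersHom (MulAut (Multiplicative (Fin 2 → ℤ))) (torusAut A))

/-- The linear form `v ↦ x₀ v₀ + x₁ v₁` on `ℤ²`, with real coefficients. -/
def linearForm (x : Fin 2 → ℝ) (v : Multiplicative (Fin 2 → ℤ)) : ℝ :=
  x 0 * (Multiplicative.toAdd v 0 : ℤ) + x 1 * ((Multiplicative.toAdd v 1 : ℤ) : ℝ)

lemma linearForm_one (x : Fin 2 → ℝ) : linearForm x 1 = 0 := by
  simp [linearForm]

lemma linearForm_mul (x : Fin 2 → ℝ) (v w : Multiplicative (Fin 2 → ℤ)) :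
    linearForm x (v * w) = linearForm x v + linearForm x w := by
  simp only [linearForm, toAdd_mul, Pi.add_apply]
  push_cast
  ring

lemma toAdd_torusAut (A : Matrix.SpecialLinearGroup (Fin 2) ℤ)
    (v : Multiplicative (Fin 2 → ℤ)) (i : Fin 2) :
    Multiplicative.toAdd (torusAut A v) i
      = A.1 i 0 * Multiplicative.toAdd v 0 + A.1 i 1 * Multiplicative.toAdd v 1 := by
  change (Matrix.mulVec A.1 (Multiplicative.toAdd v)) i = _
  simp [Matrix.mulVec, dotProduct, Fin.sum_univ_two]

lemma linearForm_torusAut_zpow {A : Matrix.SpecialLinearGroup (Fin 2) ℤ} {x : Fin 2 → ℝ} {c : ℝ}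
    (h : ∀ v, Real.exp c * linearForm x (torusAut A v) = linearForm x v) (k : ℤ) :
    ∀ v, Real.exp (c * k) * linearForm x ((torusAut A ^ k) v) = linearForm x v := by
  induction k with
  | zero => simp
  | succ n ih =>
    intro v
    rw [zpow_add_one, MulAut.mul_apply, ← h v, ← ih (torusAut A v)]
    push_cast
    rw [mul_add, Real.exp_add]
    ring_nf
  | pred n ih =>
    intro v
    have h1 := h ((torusAut A)⁻¹ v)
    rw [MulAut.apply_inv_self] at h1
    have h2 := ih ((torusAut A)⁻¹ v)
    rw [← h1] at h2
    rw [zpow_sub_one, MulAut.mul_apply]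
    have h3 : Real.exp (c * ((-(n : ℤ) - 1 : ℤ) : ℝ)) * Real.exp c
        = Real.exp (c * ((-(n : ℤ) : ℤ) : ℝ)) := by
      rw [← Real.exp_add]
      push_cast
      ring_nf
    rw [← h3] at h2
    exact mul_left_cancel₀ (Real.exp_pos c).ne' (by linarith)

/-- The representation `(v, k) ↦ (1, e^{ck} x(v); 0, e^{ck})` of `Γ_A` attached to a linear form
`x` with `e^c x(A v) = x(v)`. -/
noncomputable def affineRep {A : Matrix.SpecialLinearGroup (Fin 2) ℤ} {x : Fin 2 → ℝ} {c : ℝ}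
    (h : ∀ v, Real.exp c * linearForm x (torusAut A v) = linearForm x v) :
    GammaA A →* Matrix (Fin 2) (Fin 2) ℝ where
  toFun γ := !![1, Real.exp (c * (Multiplicative.toAdd γ.right : ℤ)) * linearForm x γ.left;
    0, Real.exp (c * (Multiplicative.toAdd γ.right : ℤ))]
  map_one' := by
    simp [linearForm_one, Matrix.one_fin_two]
  map_mul' γ δ := by
    have hk := linearForm_torusAut_zpow h (Multiplicative.toAdd γ.right) δ.left
    simp only [SemidirectProduct.mul_left, SemidirectProduct.mul_right, linearForm_mul,
      zpowersHom_apply, toAdd_mul, Int.cast_add, mul_add, Real.exp_add, Matrix.mul_fin_two,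
      EmbeddingLike.apply_eq_iff_eq]
    rw [← hk]
    congr! 3 <;> ring_nf

/-- The relation `t v t⁻¹ = A v` in `Γ_A`. -/
lemma inr_mul_inl (A : Matrix.SpecialLinearGroup (Fin 2) ℤ) (v : Multiplicative (Fin 2 → ℤ)) :
    (SemidirectProduct.inr (Multiplicative.ofAdd 1) * SemidirectProduct.inl v : GammaA A)
      = SemidirectProduct.inl (torusAut A v) * SemidirectProduct.inr (Multiplicative.ofAdd 1) := by
  ext <;> simp

lemma exists_linearForm (f : Multiplicative (Fin 2 → ℤ) → ℝ)
    (hf : ∀ v w, f (v * w) = f v + f w) : ∃ x, ∀ v, f v = linearForm x v := by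
  let F : (Fin 2 → ℤ) →+ ℝ := AddMonoidHom.mk' (fun v => f (Multiplicative.ofAdd v))
    (fun v w => hf _ _)
  refine ⟨fun i => F (Pi.single i 1), fun v => ?_⟩
  have hv : Multiplicative.toAdd v = Multiplicative.toAdd v 0 • Pi.single 0 1
      + Multiplicative.toAdd v 1 • Pi.single 1 1 := by
    ext i
    fin_cases i <;> simp
  calc f v = F (Multiplicative.toAdd v) := rfl
    _ = _ := by
      rw [hv, map_add, map_zsmul, map_zsmul]
      simp [linearForm, mul_comm]

/-- A matrix fixing `e₁` is determined by its second column. -/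
lemma eq_of_mulVec_e₁ {M : Matrix (Fin 2) (Fin 2) ℝ} (h : M.mulVec ![1, 0] = ![1, 0]) :
    M = !![1, M 0 1; 0, M.det] := by
  have h0 := congrFun h 0
  have h1 := congrFun h 1
  simp [Matrix.mulVec, dotProduct, Fin.sum_univ_two] at h0 h1
  ext i j
  fin_cases i <;> fin_cases j <;> simp [Matrix.det_fin_two, h0, h1]

/-- For `A ∈ SL₂(ℤ)` and `c ≠ 0`, with `ρ_c : Γ_A = ℤ² ⋊_A ℤ → (ℝ₊*, ×)`,
`ρ_c(v,k) = e^{ck}`: there exists a representation `ξ : Γ_A → GL₂(ℝ)` fixing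
`e₁ = (1,0)ᵀ`, with `det ∘ ξ = ρ_c` and `ξ` nontrivial on the commutator subgroup,
if and only if `e^c` is an eigenvalue of `A` viewed as a real matrix. -/
theorem stmt9 (A : Matrix.SpecialLinearGroup (Fin 2) ℤ) (c : ℝ) (hc : c ≠ 0) :
    (∃ ξ : GammaA A →* GL (Fin 2) ℝ,
      (∀ γ : GammaA A, (ξ γ : Matrix (Fin 2) (Fin 2) ℝ).mulVec ![1, 0] = ![1, 0]) ∧
      (∀ γ : GammaA A, (ξ γ : Matrix (Fin 2) (Fin 2) ℝ).det
          = Real.exp (c * (Multiplicative.toAdd γ.right : ℤ))) ∧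
      ∃ b ∈ commutator (GammaA A), ξ b ≠ 1) ↔
    (∃ w : Fin 2 → ℝ, w ≠ 0 ∧
      ((A : Matrix (Fin 2) (Fin 2) ℤ).map (Int.cast : ℤ → ℝ)).mulVec w = Real.exp c • w) := by
  have hdet : (A.1 0 0 * A.1 1 1 - A.1 0 1 * A.1 1 0 : ℝ) = 1 := by
    have := A.2
    rw [Matrix.det_fin_two] at this
    exact_mod_cast this
  constructor
  · rintro ⟨ξ, hfix, hdetξ, b, hb, hξb⟩
    have hform := fun γ => eq_of_mulVec_e₁ (hfix γ)
    simp only [hdetξ] at hform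
    obtain ⟨x, hx⟩ := exists_linearForm
      (fun v => (ξ (SemidirectProduct.inl v) : Matrix (Fin 2) (Fin 2) ℝ) 0 1) (fun v w => by
        rw [map_mul, map_mul, Units.val_mul, hform (.inl v), hform (.inl w)]
        simp [add_comm])
    have hinl : ∀ v, (ξ (.inl v) : Matrix (Fin 2) (Fin 2) ℝ) = !![1, linearForm x v; 0, 1] := by
      intro v
      rw [hform, ← hx]
      simp
    have hA : ∀ v, Real.exp c * linearForm x (torusAut A v) = linearForm x v := by
      intro v
      have h := congrArg (fun γ => (ξ γ : Matrix (Fin 2) (Fin 2) ℝ) 0 1) (inr_mul_inl A v)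
      simp only [map_mul, Units.val_mul, hinl] at h
      rw [hform (.inr (Multiplicative.ofAdd 1))] at h
      simp at h
      linarith
    have hx0 : x ≠ 0 := by
      rintro rfl
      have hbr : b.right = 1 :=
        Abelianization.commutator_subset_ker (SemidirectProduct.rightHom : GammaA A →* _) hb
      apply hξb
      rw [← SemidirectProduct.inl_left_mul_inr_right b, hbr, map_one, mul_one]
      ext1
      rw [hinl]
      simp [linearForm, Matrix.one_fin_two]
    have e0 := hA (Multiplicative.ofAdd (Pi.single 0 1))
    have e1 := hA (Multiplicative.ofAdd (Pi.single 1 1))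
    simp only [linearForm, toAdd_torusAut] at e0 e1
    simp at e0 e1
    refine ⟨![x 1, -x 0], fun h => hx0 ?_, ?_⟩
    · have h0 := congrFun h 0
      have h1 := congrFun h 1
      simp at h0 h1
      ext i
      fin_cases i <;> simp [h0, h1]
    · ext i
      fin_cases i <;> simp [Matrix.mulVec, dotProduct, Fin.sum_univ_two]
      · linear_combination (-(A.1 0 0 : ℝ)) * e1 + (A.1 0 1 : ℝ) * e0 + Real.exp c * x 1 * hdet
      · linear_combination (-(A.1 1 0 : ℝ)) * e1 + (A.1 1 1 : ℝ) * e0 - Real.exp c * x 0 * hdet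
  · rintro ⟨w, hw, hAw⟩
    have e0 := congrFun hAw 0
    have e1 := congrFun hAw 1
    simp [Matrix.mulVec, dotProduct, Fin.sum_univ_two] at e0 e1
    have hA : ∀ v, Real.exp c * linearForm ![-w 1, w 0] (torusAut A v)
        = linearForm ![-w 1, w 0] v := by
      intro v
      simp only [linearForm, toAdd_torusAut]
      simp
      set p : ℝ := ((Multiplicative.toAdd v 0 : ℤ) : ℝ)
      set q : ℝ := ((Multiplicative.toAdd v 1 : ℤ) : ℝ)
      linear_combination (A.1 0 0 * p + A.1 0 1 * q) * e1 - (A.1 1 0 * p + A.1 1 1 * q) * e0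
        + (w 0 * q - w 1 * p) * hdet
    obtain ⟨v, hv⟩ : ∃ v, linearForm ![-w 1, w 0] v ≠ 0 := by
      by_contra! h
      apply hw
      have h0 := h (Multiplicative.ofAdd (Pi.single 0 1))
      have h1 := h (Multiplicative.ofAdd (Pi.single 1 1))
      simp [linearForm] at h0 h1
      ext i
      fin_cases i <;> simp [h0, h1]
    refine ⟨(affineRep hA).toHomUnits, fun γ => ?_, fun γ => ?_, _,
      Subgroup.commutator_mem_commutator (Subgroup.mem_top (.inr (Multiplicative.ofAdd 1)))
        (Subgroup.mem_top (.inl v)), fun h => hv ?_⟩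
    · ext i
      fin_cases i <;> simp [affineRep, Matrix.mulVec, dotProduct, Fin.sum_univ_two]
    · simp [affineRep, Matrix.det_fin_two]
    · rw [map_commutatorElement, commutatorElement_eq_one_iff_mul_comm] at h
      have h' := congrArg (fun M : GL (Fin 2) ℝ => (M : Matrix (Fin 2) (Fin 2) ℝ) 0 1) h
      simp [affineRep, linearForm_one] at h'
      have hne : Real.exp c ≠ 1 := by simpa using hc
      by_contra
      exact hne (by simpa [hv] using h'.symm)
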